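/- Let d ≥ 1, let E, F, W ⊂ {1,…,d}, and let α ∈ A(E), β ∈ A(F) satisfy m_E(α) < 0 and m_F(β) < 0. Let Q(W) = ∏_{i=1}^d I_i with I_i = (π/4, π) if i ∈ W and I_i = (0, 3π/4) if i ∉ W. Define, for measurable f ≥ 0, 𝕃_{*,W}^{(α,E),(β,F)} f(θ) = sup_{0<t≤1} ∫_{(0,π)^d} χ_{{θ ∈ Q(W) and φ ∈ Q(W)}} 𝕂_t^{(α,E),(β,F)}(θ,φ) f(φ) dη_{α,β}(φ). Then there is a constant C such that η_{α,β}{θ ∈ (0,π)^d : 𝕃_{*,W}^{(α,E),(β,F)} f(θ) > λ} ≤ (C/λ) ∫_{(0,π)^d} f dη_{α,β} for every λ > 0 and every 0 ≤ f ∈ L¹(dη_{α,β}). -/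

import Mathlib

open MeasureTheory

/-- The Jacobi-type kernel
`K_t^{a,b}(θ,φ) = (θφ + t)^{−a−1/2} ((π−θ)(π−φ) + t)^{−b−1/2} t^{−1/2} exp(−c₂(θ−φ)²/t)`. -/
noncomputable def Kj (c₂ a b t θ φ : ℝ) : ℝ :=
  (θ * φ + t) ^ (-a - 1 / 2) * ((Real.pi - θ) * (Real.pi - φ) + t) ^ (-b - 1 / 2) *
    t ^ (-(1 : ℝ) / 2) * Real.exp (-c₂ * (θ - φ) ^ 2 / t)

/-- The product kernel `𝕂_t^{(α,E),(β,F)}(θ,φ)`: the `i`-th factor is the classical kernel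
`K_t^{α_i,β_i}` for `i ∉ E ∪ F`, and acquires the exotic factor `(θ_i φ_i)^{−2α_i}` together
with the sign flip `α_i ↦ −α_i` when `i ∈ E`, resp. `((π−θ_i)(π−φ_i))^{−2β_i}` together with
`β_i ↦ −β_i` when `i ∈ F`. -/
noncomputable def KKj (d : ℕ) (c₂ : ℝ) (E F : Finset (Fin d)) (α β : Fin d → ℝ)
    (t : ℝ) (θ φ : Fin d → ℝ) : ℝ :=
  ∏ i, ((θ i * φ i) ^ (if i ∈ E then -2 * α i else 0) *
    ((Real.pi - θ i) * (Real.pi - φ i)) ^ (if i ∈ F then -2 * β i else 0) *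
    Kj c₂ (if i ∈ E then -α i else α i) (if i ∈ F then -β i else β i) t (θ i) (φ i))

/-- The measure `η_{α,β}` on `(0,π)^d` with density `∏ θ_i^{2α_i+1}(π−θ_i)^{2β_i+1}`. -/
noncomputable def etaM (d : ℕ) (α β : Fin d → ℝ) : Measure (Fin d → ℝ) :=
  ((volume : Measure (Fin d → ℝ)).withDensity fun θ =>
    ENNReal.ofReal (∏ i, θ i ^ (2 * α i + 1) * (Real.pi - θ i) ^ (2 * β i + 1))).restrict
    {θ | ∀ i, 0 < θ i ∧ θ i < Real.pi}

/-- The cube `Q(W) = ∏ I_i` with `I_i = (π/4, π)` for `i ∈ W` and `I_i = (0, 3π/4)`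
otherwise. -/
def QW (d : ℕ) (W : Finset (Fin d)) : Set (Fin d → ℝ) :=
  {θ | ∀ i, (i ∈ W → Real.pi / 4 < θ i ∧ θ i < Real.pi) ∧
    (i ∉ W → 0 < θ i ∧ θ i < 3 * Real.pi / 4)}


lemma aux_vitali {X : Type*} [MeasurableSpace X] (m ρ : Measure X) [IsFiniteMeasure ρ]
    (B Bs : X → ℝ → Set X) (V : X → ℝ → ENNReal) (S : Set X) (L C : ENNReal)
    (hL : L ≠ 0) (hL' : L ≠ ⊤)
    (hB : ∀ x s, MeasurableSet (B x s))
    (hS : ∀ x ∈ S, ∃ s ∈ Set.Ioc (0:ℝ) 1, V x s * L < ρ (B x s))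
    (heng : ∀ x ∈ S, ∀ x' ∈ S, ∀ s s' : ℝ, 0 < s → 0 < s' → s ≤ 2 * s' →
      (B x s ∩ B x' s').Nonempty → x ∈ Bs x' s')
    (hV : ∀ x ∈ S, ∀ s, 0 < s → m (Bs x s) ≤ C * V x s) :
    m S ≤ C * (ρ Set.univ / L) := by
  classical
  choose! r hr hr2 using hS
  obtain ⟨u, huS, hdis, hcov⟩ := Vitali.exists_disjoint_subfamily_covering_enlargement
    (fun x => B x (r x)) S r 2 (by norm_num) (fun a ha => (hr a ha).1.le) 1 (fun a ha => (hr a ha).2)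
    (fun a ha => nonempty_of_measure_ne_zero (ne_of_gt (lt_of_le_of_lt (zero_le) (hr2 a ha))))
  have hdis' : Pairwise (Function.onFun Disjoint (fun x : u => B x (r x))) := by
    intro a b hab
    exact hdis a.2 b.2 (fun h => hab (Subtype.ext h))
  have hcount : Countable u := by
    have := Measure.countable_meas_pos_of_disjoint_iUnion (μ := ρ)
      (fun x : u => hB x (r x)) hdis'
    have h2 : {i : u | 0 < ρ (B i (r i))} = Set.univ := by
      ext i; simp only [Set.mem_ofPred_eq, Set.mem_univ, iff_true]
      exact lt_of_le_of_lt (zero_le) (hr2 i (huS i.2))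
    rw [h2] at this
    exact Set.countable_univ_iff.mp this
  have hsub : S ⊆ ⋃ b : u, Bs b (r b) := by
    intro a ha
    obtain ⟨b, hb, hne, hle⟩ := hcov a ha
    exact Set.mem_iUnion.2 ⟨⟨b, hb⟩, heng a ha b (huS hb) _ _ (hr a ha).1 (hr b (huS hb)).1 hle hne⟩
  calc m S ≤ m (⋃ b : u, Bs b (r b)) := measure_mono hsub
    _ ≤ ∑' b : u, m (Bs b (r b)) := measure_iUnion_le _
    _ ≤ ∑' b : u, C * (ρ (B b (r b)) / L) := by
        refine ENNReal.tsum_le_tsum fun b => (hV b (huS b.2) _ (hr b (huS b.2)).1).trans ?_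
        gcongr
        rw [ENNReal.le_div_iff_mul_le (Or.inl hL) (Or.inl hL')]
        exact (hr2 b (huS b.2)).le
    _ = C * (ρ (⋃ b : u, B b (r b)) / L) := by
        rw [ENNReal.tsum_mul_left, measure_iUnion hdis' (fun b => hB _ _)]
        simp only [div_eq_mul_inv, ENNReal.tsum_mul_right]
    _ ≤ C * (ρ Set.univ / L) := by gcongr; exact Set.subset_univ _

lemma aux_tsum_pi {d : ℕ} {ι : Fin d → Type} (w : ∀ i, ι i → ENNReal) :
    ∑' p : (∀ i, ι i), ∏ i, w i (p i) ≤ ∏ i, ∑' n, w i n := by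
  classical
  rw [ENNReal.tsum_eq_iSup_sum]
  refine iSup_le fun s => ?_
  calc ∑ p ∈ s, ∏ i, w i (p i)
      ≤ ∑ p ∈ Fintype.piFinset (fun i => s.image (fun p => p i)), ∏ i, w i (p i) := by
        apply Finset.sum_le_sum_of_subset
        intro p hp
        rw [Fintype.mem_piFinset]
        intro i
        exact Finset.mem_image_of_mem _ hp
    _ = ∏ i, ∑ n ∈ s.image (fun p => p i), w i n := by
        rw [Finset.prod_univ_sum]
    _ ≤ _ := Finset.prod_le_prod' fun i _ => ENNReal.sum_le_tsum _

lemma aux_lint_pi {n : ℕ} (f : Fin n → ℝ → ENNReal) (hf : ∀ i, Measurable (f i)) :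
    ∫⁻ x : Fin n → ℝ, ∏ i, f i (x i) = ∏ i, ∫⁻ x, f i x := by
  induction n with
  | zero => simp [volume_pi]
  | succ n ih =>
    have h := (volume_preserving_piFinSuccAbove (fun _ : Fin (n+1) => ℝ) 0).symm
    rw [← h.lintegral_comp_emb (MeasurableEquiv.measurableEmbedding _)]
    rw [Fin.prod_univ_succ, ← ih (fun i => f i.succ) (fun i => hf _)]
    have h2 := lintegral_prod_mul (μ := (volume : Measure ℝ)) (ν := (volume : Measure (Fin n → ℝ)))
      (f := f 0) (g := fun x => ∏ i : Fin n, f i.succ (x i)) (hf 0).aemeasurable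
      (Finset.measurable_prod _ fun i _ => (hf _).comp (measurable_pi_apply i)).aemeasurable
    rw [← h2]
    apply lintegral_congr
    intro x
    rw [Fin.prod_univ_succ]
    congr 1

/-- one-coordinate structure -/
structure Good (k : ℝ → ℝ → ℝ → ℝ) (μ : Measure ℝ) (I : Set ℝ) where
  ι : Type
  cnt : Countable ι
  w : ι → ℝ
  wpos : ∀ n, 0 < w n
  wsum : Summable w
  σ : ι → ℝ → ℝ
  σm : ∀ n, Measurable (σ n)
  B : ι → ℝ → ℝ → Set ℝ
  Bm : ∀ n x s, MeasurableSet (B n x s)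
  Bs : ι → ℝ → ℝ → Set ℝ
  Bsm : ∀ n x s, MeasurableSet (Bs n x s)
  V : ι → ℝ → ℝ → ℝ
  Vpos : ∀ n, ∀ x ∈ I, ∀ s, 0 < s → 0 < V n x s
  C : ℝ
  eng : ∀ n, ∀ x ∈ I, ∀ x' ∈ I, ∀ s s' : ℝ, 0 < s → 0 < s' → s ≤ 2 * s' →
      (B n x s ∩ B n x' s').Nonempty → x ∈ Bs n x' s'
  vol : ∀ n, ∀ x ∈ I, ∀ s, 0 < s → μ (Bs n x s) ≤ ENNReal.ofReal (C * V n x s)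
  ker : ∀ x ∈ I, ∀ y ∈ I, ∀ s, 0 < s → s ≤ 1 → ∃ n, σ n y ∈ B n x s ∧
      k (s ^ 2) x y ≤ w n ^ 2 / V n x s

lemma aux_main {d : ℕ} (k : Fin d → ℝ → ℝ → ℝ → ℝ) (μ : Fin d → Measure ℝ) (I : Fin d → Set ℝ)
    (G : ∀ i, Good (k i) (μ i) (I i)) 
    (hk : ∀ i, ∀ t, 0 < t → ∀ x ∈ I i, ∀ y ∈ I i, 0 ≤ k i t x y)
    (m : Measure (Fin d → ℝ))
    (hm : ∀ A : Fin d → Set ℝ, (∀ i, MeasurableSet (A i)) →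
      m (Set.univ.pi A) ≤ ∏ i, μ i (A i)) :
    ∃ C : ENNReal, C ≠ ⊤ ∧ ∀ ρ : Measure (Fin d → ℝ), IsFiniteMeasure ρ →
      ρ (Set.univ.pi I)ᶜ = 0 → ∀ L : ENNReal, L ≠ 0 → L ≠ ⊤ → ∀ S ⊆ Set.univ.pi I,
      (∀ x ∈ S, ∃ t ∈ Set.Ioc (0:ℝ) 1,
        L < ∫⁻ y, ENNReal.ofReal (∏ i, k i t (x i) (y i)) ∂ρ) →
      m S ≤ C * (ρ Set.univ / L) := by
  classical
  have := fun i => (G i).cnt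
  let P := ∀ i, (G i).ι
  have : Countable P := inferInstance
  let W : P → ENNReal := fun p => ∏ i, ENNReal.ofReal ((G i).w (p i))
  let Z : ENNReal := ∑' p, W p
  have hZ : Z ≠ ⊤ := by
    refine ne_top_of_le_ne_top ?_ (aux_tsum_pi (fun i n => ENNReal.ofReal ((G i).w n)))
    refine ENNReal.prod_ne_top fun i _ => ?_
    exact (G i).wsum.tsum_ofReal_ne_top
  have hWpos : ∀ p, W p ≠ 0 := fun p => Finset.prod_ne_zero_iff.2 fun i _ => by
    simpa using (G i).wpos _
  have hWtop : ∀ p, W p ≠ ⊤ := fun p => ENNReal.prod_ne_top fun i _ => ENNReal.ofReal_ne_top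
  let C0 : ENNReal := ∏ i, ENNReal.ofReal ((G i).C)
  have hC0 : C0 ≠ ⊤ := ENNReal.prod_ne_top fun i _ => ENNReal.ofReal_ne_top
  let V : P → (Fin d → ℝ) → ℝ → ENNReal := fun p x s => ∏ i, ENNReal.ofReal ((G i).V (p i) (x i) s)
  let B : P → (Fin d → ℝ) → ℝ → Set (Fin d → ℝ) := fun p x s =>
    Set.univ.pi fun i => (G i).B (p i) (x i) s
  let Bs : P → (Fin d → ℝ) → ℝ → Set (Fin d → ℝ) := fun p x s =>
    Set.univ.pi fun i => (G i).Bs (p i) (x i) s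
  let σ : P → (Fin d → ℝ) → (Fin d → ℝ) := fun p y i => (G i).σ (p i) (y i)
  have hσ : ∀ p, Measurable (σ p) := fun p => measurable_pi_lambda _ fun i =>
    ((G i).σm _).comp (measurable_pi_apply i)
  have hBm : ∀ p x s, MeasurableSet (B p x s) := fun p x s =>
    MeasurableSet.univ_pi fun i => (G i).Bm _ _ _
  refine ⟨C0 * Z * Z, by finiteness, ?_⟩
  intro ρ hρ hρI L hL hL' S hSI hS
  by_cases hZ0 : Z = 0
  · -- impossible
    have hP : IsEmpty P := by
      by_contra h
      rw [not_isEmpty_iff] at h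
      obtain ⟨p⟩ := h
      exact hWpos p (ENNReal.tsum_eq_zero.1 hZ0 p)
    have : S = ∅ := by
      by_contra h
      obtain ⟨x, hx⟩ := Set.nonempty_iff_ne_empty.2 h
      refine hP.false (fun i => ((G i).ker (x i) (hSI hx i trivial) (x i) (hSI hx i trivial) 1 one_pos le_rfl).choose)
    simp [this]
  let S' : P → Set (Fin d → ℝ) := fun p =>
    {x | x ∈ S ∧ ∃ s ∈ Set.Ioc (0:ℝ) 1, V p x s * (L / (Z * W p)) < (ρ.map (σ p)) (B p x s)}
  have hcov : S ⊆ ⋃ p, S' p := by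
    intro x hx
    obtain ⟨t, ht, hlt⟩ := hS x hx
    have hxI := hSI hx
    by_contra hcon
    simp only [Set.mem_iUnion, S', Set.mem_ofPred_eq, not_exists, not_and, not_lt] at hcon
    set s := Real.sqrt t with hs
    have hs0 : 0 < s := Real.sqrt_pos.2 ht.1
    have hs1 : s ≤ 1 := by rw [hs]; exact Real.sqrt_le_one.mpr ht.2
    have hst : s ^ 2 = t := Real.sq_sqrt ht.1.le
    have hcon' : ∀ p, (ρ.map (σ p)) (B p x s) ≤ V p x s * (L / (Z * W p)) := fun p =>
      hcon p hx s ⟨hs0, hs1⟩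
    have hVpos : ∀ p, V p x s ≠ 0 := fun p => Finset.prod_ne_zero_iff.2 fun i _ => by
      simpa using (G i).Vpos _ _ (hxI i trivial) _ hs0
    have hVtop : ∀ p, V p x s ≠ ⊤ := fun p => ENNReal.prod_ne_top fun i _ => ENNReal.ofReal_ne_top
    refine absurd hlt (not_lt.2 ?_)
    calc ∫⁻ y, ENNReal.ofReal (∏ i, k i t (x i) (y i)) ∂ρ
        ≤ ∫⁻ y, ∑' p, (σ p ⁻¹' (B p x s)).indicator (fun _ => W p ^ 2 / V p x s) y ∂ρ := by
          apply lintegral_mono_ae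
          have : ∀ᵐ y ∂ρ, y ∈ Set.univ.pi I := by
            rw [ae_iff]; exact hρI
          filter_upwards [this] with y hy
          have hch := fun i => (G i).ker (x i) (hxI i trivial) (y i) (hy i trivial) s hs0 hs1
          choose p hp1 hp2 using hch
          refine le_trans ?_ (ENNReal.le_tsum p)
          rw [Set.indicator_of_mem (show y ∈ σ p ⁻¹' (B p x s) from fun i _ => hp1 i)]
          rw [ENNReal.ofReal_prod_of_nonneg (fun i _ => hk i t ht.1 _ (hxI i trivial) _ (hy i trivial))]
          calc _ ≤ ∏ i, ENNReal.ofReal ((G i).w (p i) ^ 2 / (G i).V (p i) (x i) s) :=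
                Finset.prod_le_prod' fun i _ => ENNReal.ofReal_le_ofReal (hst ▸ hp2 i)
            _ = ∏ i, (ENNReal.ofReal ((G i).w (p i)) ^ 2 / ENNReal.ofReal ((G i).V (p i) (x i) s)) := by
                refine Finset.prod_congr rfl fun i _ => ?_
                rw [ENNReal.ofReal_div_of_pos ((G i).Vpos _ _ (hxI i trivial) _ hs0),
                  ENNReal.ofReal_pow ((G i).wpos _).le]
            _ = _ := by
                simp only [W, V, div_eq_mul_inv, Finset.prod_mul_distrib, Finset.prod_pow]
                rw [ENNReal.prod_inv_distrib]
                intro i _ j _ _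
                exact Or.inr ENNReal.ofReal_ne_top
      _ = ∑' p, W p ^ 2 / V p x s * ρ (σ p ⁻¹' (B p x s)) := by
          rw [lintegral_tsum (fun p => (measurable_const.indicator (hσ p (hBm p x s))).aemeasurable)]
          refine tsum_congr fun p => ?_
          rw [lintegral_indicator_const (hσ p (hBm p x s))]
      _ ≤ ∑' p, W p * (L / Z) := by
          refine ENNReal.tsum_le_tsum fun p => ?_
          have h := hcon' p
          rw [Measure.map_apply (hσ p) (hBm p x s)] at h
          calc _ ≤ W p ^ 2 / V p x s * (V p x s * (L / (Z * W p))) := by gcongr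
            _ = ((V p x s)⁻¹ * V p x s) * (W p * (W p)⁻¹) * (W p * (L / Z)) := by
              rw [div_eq_mul_inv, div_eq_mul_inv, div_eq_mul_inv, ENNReal.mul_inv (Or.inl hZ0) (Or.inl hZ)]
              ring
            _ = _ := by
              rw [ENNReal.inv_mul_cancel (hVpos p) (hVtop p), ENNReal.mul_inv_cancel (hWpos p) (hWtop p)]
              simp
      _ = Z * (L / Z) := by rw [ENNReal.tsum_mul_right]
      _ ≤ L := ENNReal.mul_div_le
  calc m S ≤ m (⋃ p, S' p) := measure_mono hcov
    _ ≤ ∑' p, m (S' p) := measure_iUnion_le _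
    _ ≤ ∑' p, C0 * (ρ Set.univ / (L / (Z * W p))) := by
        refine ENNReal.tsum_le_tsum fun p => ?_
        have : IsFiniteMeasure (ρ.map (σ p)) := Measure.isFiniteMeasure_map _ _
        have h := aux_vitali m (ρ.map (σ p)) (B p) (Bs p) (V p) (S' p) (L / (Z * W p)) C0
          (ENNReal.div_ne_zero.2 ⟨hL, ENNReal.mul_ne_top hZ (hWtop p)⟩)
          (ENNReal.div_ne_top hL' (mul_ne_zero hZ0 (hWpos p))) (hBm p)
          (fun x hx => hx.2) ?_ ?_
        · rwa [Measure.map_apply (hσ p) MeasurableSet.univ, Set.preimage_univ] at h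
        · intro x hx x' hx' s s' hs hs' hss ⟨z, hz, hz'⟩ i _
          exact (G i).eng (p i) _ (hSI hx.1 i trivial) _ (hSI hx'.1 i trivial) s s' hs hs' hss
            ⟨z i, hz i trivial, hz' i trivial⟩
        · intro x hx s hs
          refine (hm _ (fun i => (G i).Bsm _ _ _)).trans ?_
          simp only [C0, V, ← Finset.prod_mul_distrib]
          refine Finset.prod_le_prod' fun i _ => ?_
          refine ((G i).vol _ _ (hSI hx.1 i trivial) _ hs).trans ?_
          rw [ENNReal.ofReal_mul' ((G i).Vpos _ _ (hSI hx.1 i trivial) _ hs).le]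
    _ = ∑' p, (C0 * Z * (ρ Set.univ / L)) * W p := by
        refine tsum_congr fun p => ?_
        have h1 : Z * W p ≠ 0 := mul_ne_zero hZ0 (hWpos p)
        have h2 : Z * W p ≠ ⊤ := ENNReal.mul_ne_top hZ (hWtop p)
        rw [div_eq_mul_inv, ENNReal.inv_div (Or.inl h2) (Or.inl h1)]
        simp only [div_eq_mul_inv]; ring
    _ = _ := by rw [ENNReal.tsum_mul_left]; simp only [Z]; ring

lemma aux_cmp (u v M q : ℝ) (hu : 0 < u) (hv : 0 < v) (hM : 1 ≤ M) (h1 : u ≤ M * v)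
    (h2 : v ≤ M * u) : u ^ q ≤ M ^ |q| * v ^ q := by
  have hM0 : 0 < M := by linarith
  rcases le_total 0 q with hq | hq
  · rw [abs_of_nonneg hq, ← Real.mul_rpow hM0.le hv.le]
    exact Real.rpow_le_rpow hu.le h1 hq
  · rw [abs_of_nonpos hq]
    have : v / M ≤ u := by rw [div_le_iff₀ hM0]; linarith
    calc u ^ q ≤ (v / M) ^ q := Real.rpow_le_rpow_of_nonpos (by positivity) this hq
      _ = M ^ (-q) * v ^ q := by
        rw [Real.div_rpow hv.le hM0.le, Real.rpow_neg hM0.le]; field_simp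

lemma aux_exp (q b : ℝ) (hq : 0 ≤ q) (hb : 0 < b) :
    ∃ K : ℝ, 0 < K ∧ ∀ u : ℝ, 0 ≤ u → u ^ q * Real.exp (-b * u) ≤ K := by
  obtain ⟨m, hm⟩ := exists_nat_ge q
  refine ⟨1 + m.factorial / b ^ m, by positivity, fun u hu => ?_⟩
  rcases le_total u 1 with h | h
  · have h1 : u ^ q ≤ 1 := Real.rpow_le_one hu h hq
    have h2 : Real.exp (-b * u) ≤ 1 := Real.exp_le_one_iff.2 (by nlinarith)
    have h3 : (0:ℝ) ≤ m.factorial / b ^ m := by positivity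
    have h4 := mul_le_mul h1 h2 (Real.exp_pos _).le zero_le_one
    linarith
  · have h1 : u ^ q ≤ u ^ m := by
      rw [← Real.rpow_natCast]; exact Real.rpow_le_rpow_of_exponent_le h hm
    have h2 := Real.pow_div_factorial_le_exp (b * u) (by positivity) m
    have h3 : u ^ m * Real.exp (-b * u) ≤ m.factorial / b ^ m := by
      rw [neg_mul, Real.exp_neg, ← div_eq_mul_inv, div_le_div_iff₀ (Real.exp_pos _) (by positivity)]
      rw [div_le_iff₀ (by positivity), mul_pow] at h2
      linarith
    have := mul_le_mul_of_nonneg_right h1 (Real.exp_pos (-b * u)).le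
    linarith

lemma aux_gauss (c A : ℝ) (hc : 0 < c) :
    ∃ K : ℝ, 0 < K ∧ ∀ x y s : ℝ, 0 < s → ∃ n : ℕ, |x - y| < 2 ^ n * s ∧
      ((2:ℝ) ^ n) ^ A * Real.exp (-c * (x - y) ^ 2 / s ^ 2) ≤ K * (((1:ℝ) / 2) ^ n) ^ 2 := by
  obtain ⟨K, hK, hKu⟩ := aux_exp |A + 2| (c / 4) (abs_nonneg _) (by positivity)
  refine ⟨Real.exp c * K, by positivity, fun x y s hs => ?_⟩
  have hex : ∃ n : ℕ, |x - y| < 2 ^ n * s := by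
    obtain ⟨n, hn⟩ := pow_unbounded_of_one_lt (|x - y| / s) (one_lt_two (α := ℝ))
    exact ⟨n, by rwa [div_lt_iff₀ hs] at hn⟩
  classical
  obtain ⟨n, hn, hmin⟩ : ∃ n : ℕ, |x - y| < 2 ^ n * s ∧
      ((2:ℝ) ^ n) ^ 2 / 4 - 1 ≤ (x - y) ^ 2 / s ^ 2 := by
    refine ⟨Nat.find hex, Nat.find_spec hex, ?_⟩
    rcases hN : Nat.find hex with _ | m
    · have : 0 ≤ (x - y) ^ 2 / s ^ 2 := by positivity
      norm_num; linarith
    · have h := Nat.find_min hex (show m < Nat.find hex by omega)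
      rw [not_lt] at h
      have h2 : (2 ^ m) ^ 2 ≤ (x - y) ^ 2 / s ^ 2 := by
        rw [le_div_iff₀ (by positivity), ← mul_pow, ← sq_abs (x - y)]
        gcongr
      rw [pow_succ (2:ℝ) m]; nlinarith
  refine ⟨n, hn, ?_⟩
  set N : ℝ := 2 ^ n with hN
  have hN1 : 1 ≤ N := one_le_pow₀ (by norm_num)
  have hN0 : 0 < N := by linarith
  have e1 : Real.exp (-c * (x - y) ^ 2 / s ^ 2) ≤ Real.exp c * Real.exp (-(c/4) * N ^ 2) := by
    rw [← Real.exp_add]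
    apply Real.exp_le_exp.2
    have : -c * (x - y) ^ 2 / s ^ 2 = -c * ((x - y) ^ 2 / s ^ 2) := by ring
    rw [this]; nlinarith
  have e2 : N ^ A ≤ (N ^ 2) ^ |A + 2| * ((1 / 2) ^ n) ^ 2 := by
    have h1 : N ^ A = N ^ (A + 2) * (N ^ 2)⁻¹ := by
      rw [Real.rpow_add hN0]; norm_num; field_simp
    have h2 : (((1:ℝ) / 2) ^ n) ^ 2 = (N ^ 2)⁻¹ := by
      rw [hN, one_div, inv_pow, inv_pow]
    rw [h1, h2]
    gcongr
    calc N ^ (A + 2) ≤ N ^ |A + 2| := Real.rpow_le_rpow_of_exponent_le hN1 (le_abs_self _)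
      _ ≤ (N ^ 2) ^ |A + 2| := Real.rpow_le_rpow hN0.le (by nlinarith) (abs_nonneg _)
  have e3 := hKu (N ^ 2) (by positivity)
  calc _ ≤ ((N ^ 2) ^ |A + 2| * ((1 / 2) ^ n) ^ 2) * (Real.exp c * Real.exp (-(c/4) * N ^ 2)) := by
        gcongr
    _ = Real.exp c * ((N ^ 2) ^ |A + 2| * Real.exp (-(c/4) * N ^ 2)) * ((1 / 2) ^ n) ^ 2 := by ring
    _ ≤ _ := by gcongr

noncomputable def mu0 (A : ℝ) : Measure ℝ :=
  volume.withDensity ((Set.Ioi (0:ℝ)).indicator fun x => ENNReal.ofReal (x ^ A))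

noncomputable def k0 (c p a t x y : ℝ) : ℝ :=
  (x * y) ^ p * (x * y + t) ^ (-a - 1 / 2) * t ^ (-(1 : ℝ) / 2) * Real.exp (-c * (x - y) ^ 2 / t)

lemma mu0_le (A M l h : ℝ) (S : Set ℝ) (hS : MeasurableSet S) (hSl : S ⊆ Set.Icc l h)
    (hM : 0 ≤ M) (hb : ∀ y ∈ S, 0 < y → y ^ A ≤ M) : mu0 A S ≤ ENNReal.ofReal (M * (h - l)) := by
  rw [mu0, withDensity_apply _ hS]
  calc _ ≤ ∫⁻ x in S, ENNReal.ofReal M := by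
        refine setLIntegral_mono measurable_const fun x hx => ?_
        by_cases h0 : x ∈ Set.Ioi (0:ℝ)
        · rw [Set.indicator_of_mem h0]; exact ENNReal.ofReal_le_ofReal (hb x hx h0)
        · rw [Set.indicator_of_notMem h0]; exact zero_le
    _ = ENNReal.ofReal M * volume S := by simp
    _ ≤ ENNReal.ofReal M * volume (Set.Icc l h) := by gcongr
    _ = _ := by rw [Real.volume_Icc, ENNReal.ofReal_mul hM]

lemma mu0_le' (A h : ℝ) (hA : -1 < A) (hh : 0 < h) (S : Set ℝ) (hS : MeasurableSet S)
    (hSl : S ⊆ Set.Iic h) : mu0 A S ≤ ENNReal.ofReal (h ^ (A + 1) / (A + 1)) := by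
  rw [mu0, withDensity_apply _ hS]
  have hint : IntervalIntegrable (fun x : ℝ => x ^ A) volume 0 h := intervalIntegral.intervalIntegrable_rpow' hA
  calc _ ≤ ∫⁻ x in Set.Iic h, (Set.Ioi (0:ℝ)).indicator (fun x => ENNReal.ofReal (x ^ A)) x :=
        lintegral_mono_set hSl
    _ = ∫⁻ x in Set.Ioc 0 h, ENNReal.ofReal (x ^ A) := by
        rw [setLIntegral_indicator measurableSet_Ioi, Set.Ioi_inter_Iic]
    _ = ENNReal.ofReal (∫ x in (0:ℝ)..h, x ^ A) := by
        rw [intervalIntegral.integral_of_le hh.le, ofReal_integral_eq_lintegral_ofReal hint.1]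
        filter_upwards [ae_restrict_mem measurableSet_Ioc] with x hx
        exact Real.rpow_nonneg hx.1.le _
    _ = _ := by
        rw [integral_rpow (Or.inl hA), Real.zero_rpow (by linarith), sub_zero]

noncomputable def Good.mono {k k' : ℝ → ℝ → ℝ → ℝ} {μ μ' : Measure ℝ} {I I' : Set ℝ} (G : Good k μ I)
    (hI : I' ⊆ I) (C1 C2 : ℝ) (hC1 : 0 < C1) (hC2 : 0 < C2)
    (hk : ∀ t, 0 < t → t ≤ 1 → ∀ x ∈ I', ∀ y ∈ I', k' t x y ≤ C1 * k t x y)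
    (hμ : ∀ S, MeasurableSet S → μ' S ≤ ENNReal.ofReal C2 * μ S) : Good k' μ' I' where
  ι := G.ι
  cnt := G.cnt
  w := G.w
  wpos := G.wpos
  wsum := G.wsum
  σ := G.σ
  σm := G.σm
  B := G.B
  Bm := G.Bm
  Bs := G.Bs
  Bsm := G.Bsm
  V := fun n x s => G.V n x s / C1
  Vpos := fun n x hx s hs => div_pos (G.Vpos n x (hI hx) s hs) hC1
  C := C2 * G.C * C1
  eng := fun n x hx x' hx' => G.eng n x (hI hx) x' (hI hx')
  vol := by
    intro n x hx s hs
    refine (hμ _ (G.Bsm n x s)).trans ?_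
    refine (mul_le_mul_right (G.vol n x (hI hx) s hs) _).trans ?_
    rw [← ENNReal.ofReal_mul hC2.le]
    apply ENNReal.ofReal_le_ofReal
    apply le_of_eq; field_simp
  ker := by
    intro x hx y hy s hs hs1
    obtain ⟨n, h1, h2⟩ := G.ker x (hI hx) y (hI hy) s hs hs1
    refine ⟨n, h1, (hk _ (by positivity) (by nlinarith) x hx y hy).trans ?_⟩
    have := G.Vpos n x (hI hx) s hs
    calc C1 * k (s^2) x y ≤ C1 * (G.w n ^ 2 / G.V n x s) := by gcongr
      _ = _ := by field_simp

lemma aux_sq_rpow (s : ℝ) (hs : 0 < s) : (s ^ 2) ^ (-(1:ℝ) / 2) = s⁻¹ := by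
  rw [← Real.rpow_natCast, ← Real.rpow_mul hs.le, ← Real.rpow_neg_one]; norm_num

lemma aux_volA (a : ℝ) (ha : -1 < a) : ∃ C : ℝ, 0 < C ∧ ∀ x R : ℝ, 0 < x → 0 < R →
    mu0 (2 * a + 1) (Set.Ioo (x - 3 * R) (x + 3 * R)) ≤
      ENNReal.ofReal (C * (R * (x + R) ^ (2 * a + 1))) := by
  have h2 : 0 < 2 * a + 2 := by linarith
  refine ⟨4 ^ |2 * a + 1| * 6 + 9 ^ (2 * a + 2) / (2 * a + 2) * 7 ^ |2*a+1|, by positivity, ?_⟩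
  intro x R hx hR
  have hp : 0 < (x + R) ^ (2 * a + 1) := by positivity
  rcases le_total x (6 * R) with h | h
  · refine (mu0_le' (2 * a + 1) (9 * R) (by linarith) (by linarith) _ measurableSet_Ioo ?_).trans ?_
    · intro y hy; simp only [Set.mem_Iic]; linarith [hy.2]
    · apply ENNReal.ofReal_le_ofReal
      have e1 := aux_cmp R (x + R) 7 (2 * a + 1) hR (by linarith) (by norm_num) (by linarith) (by linarith)
      have e2 : (9 * R) ^ (2 * a + 1 + 1) = 9 ^ (2 * a + 2) * (R * R ^ (2 * a + 1)) := by
        rw [Real.mul_rpow (by norm_num) hR.le, Real.rpow_add hR (2*a+1), Real.rpow_one]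
        rw [show 2 * a + 1 + 1 = 2 * a + 2 by ring]; ring
      rw [e2, show 2 * a + 1 + 1 = 2 * a + 2 by ring]
      calc _ = 9 ^ (2 * a + 2) / (2 * a + 2) * (R * R ^ (2 * a + 1)) := by ring
        _ ≤ 9 ^ (2 * a + 2) / (2 * a + 2) * (R * (7 ^ |2*a+1| * (x + R) ^ (2 * a + 1))) := by gcongr
        _ ≤ _ := by
          have : 0 ≤ 4 ^ |2 * a + 1| * 6 * (R * (x + R) ^ (2 * a + 1)) := by positivity
          rw [add_mul]; linarith
  · refine (mu0_le (2 * a + 1) (4 ^ |2 * a + 1| * (x + R) ^ (2 * a + 1)) (x - 3 * R) (x + 3 * R) _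
      measurableSet_Ioo Set.Ioo_subset_Icc_self (by positivity) ?_).trans ?_
    · intro y hy hy0
      exact aux_cmp _ _ _ _ hy0 (by linarith) (by norm_num) (by linarith [hy.2]) (by linarith [hy.1])
    · apply ENNReal.ofReal_le_ofReal
      have : 0 ≤ 9 ^ (2 * a + 2) / (2 * a + 2) * 7 ^ |2*a+1| * (R * (x + R) ^ (2 * a + 1)) := by positivity
      rw [add_mul]; linarith

lemma goodA (c a : ℝ) (hc : 0 < c) (ha : -1 < a) :
    Nonempty (Good (k0 c 0 a) (mu0 (2 * a + 1)) (Set.Ioi 0)) := by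
  obtain ⟨C, hC, hvol⟩ := aux_volA a ha
  set q : ℝ := -a - 1 / 2 with hq
  obtain ⟨K, hK, hg⟩ := aux_gauss c (2 * |q| + 1) hc
  let D : ℝ := 9 ^ |q| * K
  have hD : 0 < D := by positivity
  refine ⟨{ 
    ι := ℕ
    cnt := inferInstance
    w := fun n => (1 / 2) ^ n
    wpos := fun n => by positivity
    wsum := summable_geometric_two
    σ := fun _ y => y
    σm := fun _ => measurable_id
    B := fun n x s => Set.Ioo (x - 2 ^ n * s) (x + 2 ^ n * s)
    Bm := fun n x s => measurableSet_Ioo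
    Bs := fun n x s => Set.Ioo (x - 3 * (2 ^ n * s)) (x + 3 * (2 ^ n * s))
    Bsm := fun n x s => measurableSet_Ioo
    V := fun n x s => (2 ^ n * s) * (x + 2 ^ n * s) ^ (2 * a + 1) / D
    Vpos := ?_
    C := C * D
    eng := ?_
    vol := ?_
    ker := ?_ }⟩
  · intro n x hx s hs
    have hx : 0 < x := hx
    positivity
  · rintro n x hx x' hx' s s' hs hs' hss ⟨z, hz, hz'⟩
    have h : (2:ℝ) ^ n * s ≤ 2 * (2 ^ n * s') := by
      have : (0:ℝ) < 2 ^ n := by positivity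
      nlinarith
    constructor <;> linarith [hz.1, hz.2, hz'.1, hz'.2]
  · intro n x hx s hs
    refine (hvol x (2 ^ n * s) hx (by positivity)).trans (le_of_eq ?_)
    congr 1; field_simp
  · intro x hx y hy s hs hs1
    have hx : 0 < x := hx
    have hy : 0 < y := hy
    obtain ⟨n, hn, he⟩ := hg x y s hs
    rw [abs_lt] at hn
    refine ⟨n, ⟨by linarith, by linarith⟩, ?_⟩
    set N : ℝ := 2 ^ n with hN
    have hN1 : 1 ≤ N := one_le_pow₀ (by norm_num)
    have hN0 : 0 < N := by linarith
    set R : ℝ := N * s with hR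
    have hR0 : 0 < R := by positivity
    have hsR : s ≤ R := by nlinarith
    have hxy : 0 < x * y := by positivity
    have c1 : x * y + s ^ 2 ≤ (x + R) ^ 2 := by nlinarith
    have c2 : (x + R) ^ 2 ≤ 9 * (x * y + R ^ 2) := by
      rcases le_total x (2 * R) with h | h
      · nlinarith
      · nlinarith
    have c3 : (x + R) ^ 2 ≤ 9 * N ^ 2 * (x * y + s ^ 2) := by
      have : x * y ≤ N ^ 2 * (x * y) := le_mul_of_one_le_left hxy.le (one_le_pow₀ hN1)
      have : R ^ 2 = N ^ 2 * s ^ 2 := by rw [hR]; ring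
      nlinarith
    have c4 := aux_cmp (x * y + s ^ 2) ((x + R) ^ 2) (9 * N ^ 2) q (by positivity) (by positivity)
      (by nlinarith) (by nlinarith [sq_nonneg (x + R)]) c3
    have c5 : ((x + R) ^ 2) ^ q = ((x + R) ^ (2 * a + 1))⁻¹ := by
      rw [← Real.rpow_natCast, ← Real.rpow_mul (by positivity), ← Real.rpow_neg (by positivity)]
      congr 1; rw [hq]; push_cast; ring
    have c6 : (9 * N ^ 2) ^ |q| * N = 9 ^ |q| * N ^ (2 * |q| + 1) := by
      rw [Real.mul_rpow (by norm_num) (by positivity), Real.rpow_add hN0, Real.rpow_one,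
        ← Real.rpow_natCast, ← Real.rpow_mul hN0.le]
      push_cast; ring
    have c7 : s⁻¹ = N * R⁻¹ := by rw [hR]; field_simp
    rw [k0, aux_sq_rpow s hs, Real.rpow_zero, one_mul, ← hq]
    have hpp : 0 < (x + R) ^ (2 * a + 1) := by positivity
    calc _ ≤ (9 * N ^ 2) ^ |q| * ((x + R) ^ 2) ^ q * s⁻¹ * Real.exp (-c * (x - y) ^ 2 / s ^ 2) := by gcongr
      _ = 9 ^ |q| * (N ^ (2 * |q| + 1) * Real.exp (-c * (x - y) ^ 2 / s ^ 2)) * (R⁻¹ * ((x + R) ^ (2 * a + 1))⁻¹) := by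
        rw [c5, c7]
        calc _ = ((9 * N ^ 2) ^ |q| * N) * Real.exp (-c * (x - y) ^ 2 / s ^ 2) * (R⁻¹ * ((x + R) ^ (2 * a + 1))⁻¹) := by ring
          _ = _ := by rw [c6]; ring
      _ ≤ 9 ^ |q| * (K * ((1 / 2) ^ n) ^ 2) * (R⁻¹ * ((x + R) ^ (2 * a + 1))⁻¹) := by gcongr
      _ = _ := by simp only [D]; field_simp

lemma aux_volB (A : ℝ) : ∃ C : ℝ, 0 < C ∧ (∀ x R : ℝ, 0 < x → 0 < R →
    mu0 A (Set.Ioo (x - 3 * R) (x + 3 * R) ∩ Set.Ioo (x / 4) (4 * x)) ≤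
      ENNReal.ofReal (C * (R * x ^ A))) ∧ (∀ x : ℝ, 0 < x →
    mu0 A (Set.Ioo (x / 4) (4 * x)) ≤ ENNReal.ofReal (C * x ^ (A + 1))) := by
  refine ⟨4 ^ |A| * 6, by positivity, ?_, ?_⟩
  · intro x R hx hR
    refine (mu0_le A (4 ^ |A| * x ^ A) (x - 3 * R) (x + 3 * R) _
      (measurableSet_Ioo.inter measurableSet_Ioo)
      (Set.inter_subset_left.trans Set.Ioo_subset_Icc_self) (by positivity) ?_).trans ?_
    · intro y hy hy0
      exact aux_cmp _ _ _ _ hy0 hx (by norm_num) (by linarith [hy.2.2]) (by linarith [hy.2.1])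
    · apply ENNReal.ofReal_le_ofReal
      apply le_of_eq; ring
  · intro x hx
    refine (mu0_le A (4 ^ |A| * x ^ A) (x / 4) (4 * x) _
      measurableSet_Ioo Set.Ioo_subset_Icc_self (by positivity) ?_).trans ?_
    · intro y hy hy0
      exact aux_cmp _ _ _ _ hy0 hx (by norm_num) (by linarith [hy.2]) (by linarith [hy.1])
    · apply ENNReal.ofReal_le_ofReal
      rw [Real.rpow_add hx, Real.rpow_one]
      have : 0 ≤ 4 ^ |A| * x ^ A * x := by positivity
      nlinarith

lemma aux_kerB1 (c a : ℝ) (hc : 0 < c) (ha : a < 0) : ∃ D : ℝ, 0 < D ∧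
    ∀ x y s : ℝ, 0 < x → 0 < s → x / 2 < y → y < 2 * x → ∃ n : ℕ, |x - y| < 2 ^ n * s ∧
      k0 c (-2 * a) (-a) (s ^ 2) x y ≤ (((1:ℝ) / 2) ^ n) ^ 2 / ((2 ^ n * s) * x ^ (2 * a + 1) / D) := by
  obtain ⟨K, hK, hg⟩ := aux_gauss c 1 hc
  refine ⟨2 ^ |-a - 1/2| * K, by positivity, ?_⟩
  intro x y s hx hs h1 h2
  obtain ⟨n, hn, he⟩ := hg x y s hs
  refine ⟨n, hn, ?_⟩
  rw [Real.rpow_one] at he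
  set N : ℝ := 2 ^ n with hN
  have hN0 : 0 < N := by positivity
  have hy : 0 < y := by linarith
  have hxy : 0 < x * y := by positivity
  have c1 : (x * y) ^ (-2 * a) * (x * y + s ^ 2) ^ (- -a - 1 / 2) ≤ (x * y) ^ (-a - 1 / 2) := by
    calc _ ≤ (x * y) ^ (-2 * a) * (x * y) ^ (- -a - 1 / 2) := by
          gcongr 1
          exact Real.rpow_le_rpow_of_nonpos hxy (by nlinarith) (by linarith)
      _ = _ := by rw [← Real.rpow_add hxy]; congr 1; ring
  have c2 := aux_cmp (x * y) (x ^ 2) 2 (-a - 1/2) hxy (by positivity) (by norm_num)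
    (by nlinarith) (by nlinarith)
  have c3 : (x ^ 2) ^ (-a - 1/2) = (x ^ (2 * a + 1))⁻¹ := by
    rw [← Real.rpow_natCast, ← Real.rpow_mul (by positivity), ← Real.rpow_neg (by positivity)]
    congr 1; push_cast; ring
  rw [k0, aux_sq_rpow s hs]
  calc _ ≤ (2 ^ |-a - 1/2| * (x ^ 2) ^ (-a - 1/2)) * s⁻¹ * Real.exp (-c * (x - y) ^ 2 / s ^ 2) := by
        gcongr ?_ * _ * _
        exact c1.trans c2
    _ = 2 ^ |-a - 1/2| * (N * Real.exp (-c * (x - y) ^ 2 / s ^ 2)) * ((N * s)⁻¹ * (x ^ (2 * a + 1))⁻¹) := by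
        rw [c3]; field_simp
    _ ≤ 2 ^ |-a - 1/2| * (K * ((1 / 2) ^ n) ^ 2) * ((N * s)⁻¹ * (x ^ (2 * a + 1))⁻¹) := by gcongr
    _ = _ := by field_simp

lemma aux_kerB2 (c a : ℝ) (hc : 0 < c) (ha : a < 0) : ∃ D : ℝ, 0 < D ∧ ∃ θ : ℝ, 0 < θ ∧ θ < 1 ∧
    ∀ x y s : ℝ, 0 < x → 0 < y → 0 < s → (y ≤ x / 2 ∨ 2 * x ≤ y) → ∃ m : ℤ,
      (x / 2 < (2:ℝ) ^ (-m) * y ∧ (2:ℝ) ^ (-m) * y < 2 * x) ∧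
      k0 c (-2 * a) (-a) (s ^ 2) x y ≤ (θ ^ m.natAbs) ^ 2 / (x ^ (2 * a + 2) / D) := by
  obtain ⟨K, hK, hg⟩ := aux_exp (1 - a) (c / 4) (by linarith) (by positivity)
  set κ : ℝ := min 1 (-a) with hκ
  have hκ0 : 0 < κ := lt_min one_pos (by linarith)
  have hκ1 : κ ≤ 1 := min_le_left _ _
  have hκ2 : κ ≤ -a := min_le_right _ _
  set θ : ℝ := 2 ^ (-κ) with hθ
  refine ⟨2 ^ (-2 * a) * K, by positivity, θ, by positivity, ?_, ?_⟩
  · exact Real.rpow_lt_one_of_one_lt_of_neg (by norm_num) (by linarith)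
  intro x y s hx hy hs hxy
  obtain ⟨m, hm1, hm2⟩ := exists_mem_Ico_zpow (div_pos hy hx) (one_lt_two (α := ℝ))
  refine ⟨m, ?_, ?_⟩
  · rw [le_div_iff₀ hx] at hm1
    rw [div_lt_iff₀ hx, zpow_add₀ (by norm_num), zpow_one] at hm2
    rw [zpow_neg]
    have hp : (0:ℝ) < 2 ^ m := by positivity
    have h1 : x ≤ (2 ^ m)⁻¹ * y := by rw [inv_mul_eq_div, le_div_iff₀ hp]; linarith
    have h2 : (2 ^ m)⁻¹ * y < 2 * x := by rw [inv_mul_eq_div, div_lt_iff₀ hp]; linarith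
    exact ⟨by linarith, h2⟩
  set z : ℝ := y / x with hz
  have hz0 : 0 < z := by positivity
  have hyz : y = z * x := by rw [hz]; field_simp
  set M : ℝ := max 1 z with hM
  have hM1 : 1 ≤ M := le_max_left _ _
  have hM0 : 0 < M := by linarith
  -- gaussian part
  have g1 : (M * x) ^ 2 / 4 ≤ (x - y) ^ 2 := by
    rcases hxy with h | h
    · have : z ≤ 1 := by rw [hz, div_le_one hx]; linarith
      rw [hM, max_eq_left this]; nlinarith
    · have : 1 ≤ z := by rw [hz, one_le_div hx]; linarith
      rw [hM, max_eq_right this, ← hyz]; nlinarith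
  have g2 : (s ^ 2) ^ (a - 1) * Real.exp (-c * (x - y) ^ 2 / s ^ 2) ≤ K * ((M * x) ^ 2) ^ (a - 1) := by
    have h := hg ((M * x) ^ 2 / s ^ 2) (by positivity)
    have h1 : Real.exp (-c * (x - y) ^ 2 / s ^ 2) ≤ Real.exp (-(c / 4) * ((M * x) ^ 2 / s ^ 2)) := by
      apply Real.exp_le_exp.2
      rw [show -(c / 4) * ((M * x) ^ 2 / s ^ 2) = (-c * ((M * x) ^ 2 / 4)) / s ^ 2 by ring]
      gcongr ?_ / _
      nlinarith
    have h2 : (s ^ 2) ^ (a - 1) = ((M * x) ^ 2 / s ^ 2) ^ (1 - a) * ((M * x) ^ 2) ^ (a - 1) := by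
      rw [Real.div_rpow (by positivity) (by positivity), show a - 1 = -(1 - a) by ring,
        Real.rpow_neg (by positivity), Real.rpow_neg (by positivity)]
      field_simp
    rw [h2]
    calc _ ≤ ((M * x) ^ 2 / s ^ 2) ^ (1 - a) * ((M * x) ^ 2) ^ (a - 1) * Real.exp (-(c / 4) * ((M * x) ^ 2 / s ^ 2)) := by gcongr
      _ = (((M * x) ^ 2 / s ^ 2) ^ (1 - a) * Real.exp (-(c / 4) * ((M * x) ^ 2 / s ^ 2))) * ((M * x) ^ 2) ^ (a - 1) := by ring
      _ ≤ _ := by gcongr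
  have g3 : k0 c (-2 * a) (-a) (s ^ 2) x y ≤ (x * y) ^ (-2 * a) * (K * ((M * x) ^ 2) ^ (a - 1)) := by
    rw [k0]
    have e1 : (x * y + s ^ 2) ^ (- -a - 1 / 2) ≤ (s ^ 2) ^ (- -a - 1 / 2) :=
      Real.rpow_le_rpow_of_nonpos (by positivity) (by nlinarith) (by linarith)
    calc _ ≤ (x * y) ^ (-2 * a) * (s ^ 2) ^ (- -a - 1 / 2) * (s ^ 2) ^ (-(1 : ℝ) / 2) * Real.exp (-c * (x - y) ^ 2 / s ^ 2) := by gcongr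
      _ = (x * y) ^ (-2 * a) * ((s ^ 2) ^ (a - 1) * Real.exp (-c * (x - y) ^ 2 / s ^ 2)) := by
        rw [show a - 1 = (- -a - 1 / 2) + (-(1:ℝ)/2) by ring, Real.rpow_add (by positivity)]; ring
      _ ≤ _ := by gcongr
  have g4 : (x * y) ^ (-2 * a) * ((M * x) ^ 2) ^ (a - 1) = (z ^ (-2 * a) * M ^ (2 * a - 2)) / x ^ (2 * a + 2) := by
    rw [hyz, show x * (z * x) = z * x ^ 2 by ring, Real.mul_rpow hz0.le (by positivity), mul_pow,
      Real.mul_rpow (by positivity) (by positivity)]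
    simp only [← Real.rpow_natCast]
    rw [← Real.rpow_mul hx.le, ← Real.rpow_mul hx.le, ← Real.rpow_mul hM0.le, eq_div_iff (by positivity)]
    calc _ = z ^ (-2 * a) * M ^ (((2:ℕ):ℝ) * (a - 1)) * (x ^ (((2:ℕ):ℝ) * (-2 * a)) * x ^ (((2:ℕ):ℝ) * (a - 1)) * x ^ (2 * a + 2)) := by ring
      _ = _ := by
        rw [← Real.rpow_add hx, ← Real.rpow_add hx]
        push_cast
        rw [show 2 * (-2 * a) + 2 * (a - 1) + (2 * a + 2) = 0 by ring, Real.rpow_zero, mul_one,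
          show 2 * (a - 1) = 2 * a - 2 by ring]
  have hθm : (θ ^ m.natAbs) ^ 2 = 2 ^ (-(2 * κ * (m.natAbs : ℝ))) := by
    rw [hθ, ← pow_mul, ← Real.rpow_natCast, ← Real.rpow_mul (by norm_num)]
    congr 1; push_cast; ring
  have g5 : z ^ (-2 * a) * M ^ (2 * a - 2) ≤ 2 ^ (-2 * a) * (θ ^ m.natAbs) ^ 2 := by
    rw [hθm]
    rw [← Real.rpow_intCast] at hm1 hm2
    have h1two : (1:ℝ) ≤ 2 ^ (-2 * a) := Real.one_le_rpow (by norm_num) (by linarith)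
    rcases le_or_gt 0 m with h0 | h0
    · have hcast : ((m.natAbs : ℕ) : ℝ) = (m : ℝ) := by
        rw [Nat.cast_natAbs, abs_of_nonneg h0]
      have hm0 : (0:ℝ) ≤ m := by exact_mod_cast h0
      have hz1 : 1 ≤ z := (Real.one_le_rpow (by norm_num) hm0).trans hm1
      rw [hM, max_eq_right hz1, ← Real.rpow_add hz0, show -2 * a + (2 * a - 2) = -2 by ring, hcast]
      calc z ^ (-2:ℝ) ≤ ((2:ℝ) ^ (m:ℝ)) ^ (-2:ℝ) :=
            Real.rpow_le_rpow_of_nonpos (by positivity) hm1 (by norm_num)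
        _ = 2 ^ ((m:ℝ) * (-2)) := by rw [← Real.rpow_mul (by norm_num)]
        _ ≤ 2 ^ (-(2 * κ * (m:ℝ))) := Real.rpow_le_rpow_of_exponent_le (by norm_num) (by nlinarith)
        _ ≤ _ := le_mul_of_one_le_left (by positivity) h1two
    · have hcast : ((m.natAbs : ℕ) : ℝ) = -(m : ℝ) := by
        rw [Nat.cast_natAbs, abs_of_neg h0]; push_cast; rfl
      have hm0 : (m:ℝ) + 1 ≤ 0 := by exact_mod_cast (show m + 1 ≤ 0 by omega)
      push_cast at hm2
      have hz1 : z ≤ 1 := hm2.le.trans (Real.rpow_le_one_of_one_le_of_nonpos (by norm_num) hm0)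
      rw [hM, max_eq_left hz1, Real.one_rpow, mul_one, hcast]
      calc z ^ (-2 * a) ≤ ((2:ℝ) ^ ((m:ℝ) + 1)) ^ (-2 * a) :=
            Real.rpow_le_rpow hz0.le hm2.le (by linarith)
        _ = 2 ^ (-2 * a) * 2 ^ (m * (-2 * a)) := by
            rw [← Real.rpow_mul (by norm_num), ← Real.rpow_add (by norm_num)]; congr 1; ring
        _ ≤ _ := by
            gcongr 2 ^ (-2 * a) * ?_
            exact Real.rpow_le_rpow_of_exponent_le (by norm_num) (by nlinarith)
  calc _ ≤ _ := g3
    _ = K * ((x * y) ^ (-2 * a) * ((M * x) ^ 2) ^ (a - 1)) := by ring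
    _ = K * ((z ^ (-2 * a) * M ^ (2 * a - 2)) / x ^ (2 * a + 2)) := by rw [g4]
    _ ≤ K * ((2 ^ (-2 * a) * (θ ^ m.natAbs) ^ 2) / x ^ (2 * a + 2)) := by gcongr
    _ = _ := by field_simp

lemma goodB (c a : ℝ) (hc : 0 < c) (ha : a < 0) :
    Nonempty (Good (k0 c (-2 * a) (-a)) (mu0 (2 * a + 1)) (Set.Ioi 0)) := by
  obtain ⟨C, hC, hv1, hv2⟩ := aux_volB (2 * a + 1)
  obtain ⟨D1, hD1, hk1⟩ := aux_kerB1 c a hc ha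
  obtain ⟨D2, hD2, θ, hθ0, hθ1, hk2⟩ := aux_kerB2 c a hc ha
  refine ⟨{ 
    ι := ℕ ⊕ ℤ
    cnt := inferInstance
    w := Sum.elim (fun n => (1 / 2) ^ n) (fun m => θ ^ m.natAbs)
    wpos := ?_
    wsum := ?_
    σ := Sum.elim (fun _ y => y) (fun m y => (2:ℝ) ^ (-m) * y)
    σm := ?_
    B := Sum.elim (fun n x s => Set.Ioo (x - 2 ^ n * s) (x + 2 ^ n * s) ∩ Set.Ioo (x / 2) (2 * x))
      (fun m x s => Set.Ioo (x / 2) (2 * x))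
    Bm := ?_
    Bs := Sum.elim (fun n x s => Set.Ioo (x - 3 * (2 ^ n * s)) (x + 3 * (2 ^ n * s)) ∩ Set.Ioo (x / 4) (4 * x))
      (fun m x s => Set.Ioo (x / 4) (4 * x))
    Bsm := ?_
    V := Sum.elim (fun n x s => (2 ^ n * s) * x ^ (2 * a + 1) / D1) (fun m x s => x ^ (2 * a + 2) / D2)
    Vpos := ?_
    C := C * (D1 + D2)
    eng := ?_
    vol := ?_
    ker := ?_ }⟩
  · rintro (n | m) <;> simp <;> positivity
  · refine Summable.sum _ ?_ ?_
    · exact summable_geometric_two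
    · have := summable_geometric_of_lt_one hθ0.le hθ1
      refine Summable.of_nat_of_neg ?_ ?_ <;> simpa using this
  · rintro (n | m)
    · exact measurable_id
    · exact measurable_const_mul _
  · rintro (n | m) x s
    · exact measurableSet_Ioo.inter measurableSet_Ioo
    · exact measurableSet_Ioo
  · rintro (n | m) x s
    · exact measurableSet_Ioo.inter measurableSet_Ioo
    · exact measurableSet_Ioo
  · rintro (n | m) x hx s hs
    · have hx : 0 < x := hx
      simp only [Sum.elim_inl]; positivity
    · have hx : 0 < x := hx
      simp only [Sum.elim_inr]; positivity
  · rintro (n | m) x hx x' hx' s s' hs hs' hss ⟨z, hz, hz'⟩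
    · simp only [Sum.elim_inl] at hz hz' ⊢
      have h : (2:ℝ) ^ n * s ≤ 2 * (2 ^ n * s') := by
        have : (0:ℝ) < 2 ^ n := by positivity
        nlinarith
      refine ⟨⟨?_, ?_⟩, ?_, ?_⟩ <;>
        linarith [hz.1.1, hz.1.2, hz'.1.1, hz'.1.2, hz.2.1, hz.2.2, hz'.2.1, hz'.2.2]
    · simp only [Sum.elim_inr] at hz hz' ⊢
      constructor <;> linarith [hz.1, hz.2, hz'.1, hz'.2]
  · rintro (n | m) x hx s hs
    · have hx : 0 < x := hx
      simp only [Sum.elim_inl]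
      refine (hv1 x (2 ^ n * s) hx (by positivity)).trans (ENNReal.ofReal_le_ofReal ?_)
      calc _ = C * D1 * (2 ^ n * s * x ^ (2 * a + 1) / D1) := by field_simp
        _ ≤ _ := by gcongr; linarith
    · have hx : 0 < x := hx
      simp only [Sum.elim_inr]
      refine (hv2 x hx).trans (ENNReal.ofReal_le_ofReal ?_)
      rw [show 2 * a + 1 + 1 = 2 * a + 2 by ring]
      calc _ = C * D2 * (x ^ (2 * a + 2) / D2) := by field_simp
        _ ≤ _ := by gcongr; linarith
  · intro x hx y hy s hs hs1
    have hx : 0 < x := hx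
    have hy : 0 < y := hy
    by_cases h : x / 2 < y ∧ y < 2 * x
    · obtain ⟨n, hn, hk⟩ := hk1 x y s hx hs h.1 h.2
      rw [abs_lt] at hn
      exact ⟨Sum.inl n, ⟨⟨by simp only [Sum.elim_inl]; linarith, by simp only [Sum.elim_inl]; linarith⟩, h⟩, hk⟩
    · have h' : y ≤ x / 2 ∨ 2 * x ≤ y := by
        by_contra hh; push Not at hh; exact h hh
      obtain ⟨m, hm, hk⟩ := hk2 x y s hx hy hs h'
      exact ⟨Sum.inr m, hm, hk⟩

noncomputable def muf (A B : ℝ) (I : Set ℝ) : Measure ℝ :=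
  volume.withDensity (I.indicator fun x => ENNReal.ofReal (x ^ A * (Real.pi - x) ^ B))

noncomputable def kf (c p a q b t x y : ℝ) : ℝ :=
  (x * y) ^ p * ((Real.pi - x) * (Real.pi - y)) ^ q * Kj c a b t x y

lemma aux_bdd (l h q u : ℝ) (hl : 0 < l) (h1 : l ≤ u) (h2 : u ≤ h) : u ^ q ≤ l ^ q + h ^ q := by
  have hu : 0 < u := by linarith
  have hh : 0 < h := by linarith
  have p1 : 0 < l ^ q := by positivity
  have p2 : 0 < h ^ q := by positivity
  rcases le_total 0 q with hq | hq
  · have := Real.rpow_le_rpow hu.le h2 hq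
    linarith
  · have := Real.rpow_le_rpow_of_nonpos hl h1 hq
    linarith

lemma goodJ (c p a q b A B : ℝ) (G : Nonempty (Good (k0 c p a) (mu0 A) (Set.Ioi 0))) :
    Nonempty (Good (kf c p a q b) (muf A B (Set.Ioo 0 (3 * Real.pi / 4))) (Set.Ioo 0 (3 * Real.pi / 4))) := by
  obtain ⟨G⟩ := G
  have hpi := Real.pi_pos
  let D : ℝ → ℝ := fun r => (Real.pi ^ 2 / 16) ^ r + (Real.pi ^ 2 + 1) ^ r
  have hD : ∀ r, 0 < D r := fun r => by positivity
  let D' : ℝ := (Real.pi / 4) ^ B + Real.pi ^ B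
  have hD' : 0 < D' := by positivity
  refine ⟨G.mono (fun x hx => hx.1) (D q * D (-b - 1/2)) D' (mul_pos (hD _) (hD _)) hD' ?_ ?_⟩
  · intro t ht ht1 x hx y hy
    have hx0 := hx.1
    have hy0 := hy.1
    have hx1 := hx.2
    have hy1 := hy.2
    have l1 : Real.pi ^ 2 / 16 ≤ (Real.pi - x) * (Real.pi - y) := by nlinarith
    have l2 : (Real.pi - x) * (Real.pi - y) ≤ Real.pi ^ 2 := by nlinarith
    have b1 : ((Real.pi - x) * (Real.pi - y)) ^ q ≤ D q :=
      aux_bdd _ _ _ _ (by positivity) l1 (by linarith)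
    have b2 : ((Real.pi - x) * (Real.pi - y) + t) ^ (-b - 1/2) ≤ D (-b - 1/2) :=
      aux_bdd _ _ _ _ (by positivity) (by linarith) (by linarith)
    have p0 : 0 ≤ (Real.pi - x) * (Real.pi - y) := le_trans (by positivity) l1
    rw [kf, Kj, k0]
    have n1 : 0 ≤ (x * y) ^ p * (x * y + t) ^ (-a - 1 / 2) * t ^ (-(1 : ℝ) / 2) * Real.exp (-c * (x - y) ^ 2 / t) := by
      positivity
    calc _ = (((Real.pi - x) * (Real.pi - y)) ^ q * ((Real.pi - x) * (Real.pi - y) + t) ^ (-b - 1/2)) *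
          ((x * y) ^ p * (x * y + t) ^ (-a - 1 / 2) * t ^ (-(1 : ℝ) / 2) * Real.exp (-c * (x - y) ^ 2 / t)) := by ring
      _ ≤ _ := by
        apply mul_le_mul_of_nonneg_right _ n1
        exact mul_le_mul b1 b2 (by positivity) (hD _).le
  · intro S hS
    rw [muf, mu0, withDensity_apply _ hS, withDensity_apply _ hS, ← lintegral_const_mul' _ _ ENNReal.ofReal_ne_top]
    apply lintegral_mono
    intro x
    by_cases hx : x ∈ Set.Ioo 0 (3 * Real.pi / 4)
    · have hx' : x ∈ Set.Ioi (0:ℝ) := hx.1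
      have hx0 : 0 < x := hx.1
      simp only [Set.indicator_of_mem hx, Set.indicator_of_mem hx']
      rw [← ENNReal.ofReal_mul hD'.le]
      apply ENNReal.ofReal_le_ofReal
      have b1 : (Real.pi - x) ^ B ≤ D' :=
        aux_bdd _ _ _ _ (by positivity) (by linarith [hx.2]) (by linarith)
      rw [mul_comm]
      gcongr
    · rw [Set.indicator_of_notMem hx]; exact zero_le

lemma muf_reflect (A B : ℝ) (S : Set ℝ) (hS : MeasurableSet S) :
    muf A B (Set.Ioo (Real.pi / 4) Real.pi) ((fun x => Real.pi - x) ⁻¹' S) =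
      muf B A (Set.Ioo 0 (3 * Real.pi / 4)) S := by
  have hm : Measurable (fun x : ℝ => Real.pi - x) := by fun_prop
  rw [muf, muf, withDensity_apply _ hS, withDensity_apply _ (hm hS), ← lintegral_indicator hS,
    ← lintegral_indicator (hm hS)]
  rw [← lintegral_sub_left_eq_self
    (S.indicator fun a => (Set.Ioo 0 (3 * Real.pi / 4)).indicator
      (fun x => ENNReal.ofReal (x ^ B * (Real.pi - x) ^ A)) a) Real.pi]
  apply lintegral_congr
  intro x
  have h1 : x ∈ Set.Ioo (Real.pi / 4) Real.pi ↔ Real.pi - x ∈ Set.Ioo 0 (3 * Real.pi / 4) := by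
    constructor
    · intro h; constructor <;> linarith [h.1, h.2]
    · intro h; constructor <;> linarith [h.1, h.2]
  by_cases h2 : Real.pi - x ∈ S
  · rw [Set.indicator_of_mem h2, Set.indicator_of_mem (show x ∈ (fun x => Real.pi - x) ⁻¹' S from h2)]
    by_cases h3 : Real.pi - x ∈ Set.Ioo 0 (3 * Real.pi / 4)
    · rw [Set.indicator_of_mem h3, Set.indicator_of_mem (h1.2 h3), sub_sub_cancel, mul_comm]
    · rw [Set.indicator_of_notMem h3, Set.indicator_of_notMem (fun h => h3 (h1.1 h))]
  · rw [Set.indicator_of_notMem h2, Set.indicator_of_notMem (show x ∉ (fun x => Real.pi - x) ⁻¹' S from h2)]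

lemma kf_reflect (c p a q b t x y : ℝ) :
    kf c p a q b t x y = kf c q b p a t (Real.pi - x) (Real.pi - y) := by
  simp only [kf, Kj, sub_sub_cancel]
  rw [show (Real.pi - x - (Real.pi - y)) ^ 2 = (x - y) ^ 2 by ring]
  ring

lemma goodR (c p a q b A B : ℝ)
    (G : Nonempty (Good (kf c q b p a) (muf B A (Set.Ioo 0 (3 * Real.pi / 4))) (Set.Ioo 0 (3 * Real.pi / 4)))) :
    Nonempty (Good (kf c p a q b) (muf A B (Set.Ioo (Real.pi / 4) Real.pi)) (Set.Ioo (Real.pi / 4) Real.pi)) := by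
  obtain ⟨G⟩ := G
  have hm : Measurable (fun x : ℝ => Real.pi - x) := by fun_prop
  have h1 : ∀ x, x ∈ Set.Ioo (Real.pi / 4) Real.pi → Real.pi - x ∈ Set.Ioo 0 (3 * Real.pi / 4) := by
    intro x h; constructor <;> linarith [h.1, h.2]
  exact ⟨{
    ι := G.ι
    cnt := G.cnt
    w := G.w
    wpos := G.wpos
    wsum := G.wsum
    σ := fun n y => G.σ n (Real.pi - y)
    σm := fun n => (G.σm n).comp hm
    B := fun n x s => G.B n (Real.pi - x) s
    Bm := fun n x s => G.Bm _ _ _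
    Bs := fun n x s => (fun x => Real.pi - x) ⁻¹' (G.Bs n (Real.pi - x) s)
    Bsm := fun n x s => hm (G.Bsm _ _ _)
    V := fun n x s => G.V n (Real.pi - x) s
    Vpos := fun n x hx s hs => G.Vpos n _ (h1 x hx) s hs
    C := G.C
    eng := fun n x hx x' hx' => G.eng n _ (h1 x hx) _ (h1 x' hx')
    vol := fun n x hx s hs => by
      rw [muf_reflect A B _ (G.Bsm _ _ _)]
      exact G.vol n _ (h1 x hx) s hs
    ker := fun x hx y hy s hs hs1 => by
      rw [kf_reflect]
      exact G.ker _ (h1 x hx) _ (h1 y hy) s hs hs1 }⟩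

def IW (d : ℕ) (W : Finset (Fin d)) (i : Fin d) : Set ℝ :=
  if i ∈ W then Set.Ioo (Real.pi / 4) Real.pi else Set.Ioo 0 (3 * Real.pi / 4)

lemma IW_meas (d : ℕ) (W : Finset (Fin d)) (i : Fin d) : MeasurableSet (IW d W i) := by
  rw [IW]; split_ifs <;> exact measurableSet_Ioo

lemma IW_sub (d : ℕ) (W : Finset (Fin d)) (i : Fin d) (x : ℝ) (hx : x ∈ IW d W i) :
    0 < x ∧ x < Real.pi := by
  have := Real.pi_pos
  rw [IW] at hx; split_ifs at hx
  · exact ⟨by linarith [hx.1], hx.2⟩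
  · exact ⟨hx.1, by linarith [hx.2]⟩

lemma QW_eq (d : ℕ) (W : Finset (Fin d)) : QW d W = Set.univ.pi (IW d W) := by
  ext θ
  simp only [QW, IW, Set.mem_ofPred_eq, Set.mem_pi, Set.mem_univ, true_imp_iff]
  refine forall_congr' fun i => ?_
  by_cases h : i ∈ W <;> simp [h]

lemma eta_box (d : ℕ) (W : Finset (Fin d)) (α β : Fin d → ℝ) (A : Fin d → Set ℝ)
    (hA : ∀ i, MeasurableSet (A i)) :
    (etaM d α β).restrict (QW d W) (Set.univ.pi A) ≤
      ∏ i, muf (2 * α i + 1) (2 * β i + 1) (IW d W i) (A i) := by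
  have hQ : MeasurableSet (QW d W) := by
    rw [QW_eq]; exact MeasurableSet.univ_pi (IW_meas d W)
  have hbox : MeasurableSet (Set.univ.pi fun i => A i ∩ IW d W i) :=
    MeasurableSet.univ_pi fun i => (hA i).inter (IW_meas d W i)
  rw [Measure.restrict_apply (MeasurableSet.univ_pi hA), QW_eq, ← Set.pi_inter_distrib, etaM]
  refine (Measure.restrict_apply_le _ _).trans ?_
  rw [withDensity_apply _ hbox, ← lintegral_indicator hbox]
  have hmeas : ∀ i, Measurable ((A i).indicator ((IW d W i).indicator fun x : ℝ =>
      ENNReal.ofReal (x ^ (2 * α i + 1) * (Real.pi - x) ^ (2 * β i + 1)))) := fun i =>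
    Measurable.indicator (Measurable.indicator (by fun_prop) (IW_meas d W i)) (hA i)
  have hR : ∏ i, muf (2 * α i + 1) (2 * β i + 1) (IW d W i) (A i) =
      ∏ i, ∫⁻ x, ((A i).indicator ((IW d W i).indicator fun x : ℝ =>
      ENNReal.ofReal (x ^ (2 * α i + 1) * (Real.pi - x) ^ (2 * β i + 1)))) x := by
    refine Finset.prod_congr rfl fun i _ => ?_
    rw [muf, withDensity_apply _ (hA i), ← lintegral_indicator (hA i)]
  rw [hR, ← aux_lint_pi _ hmeas]
  apply lintegral_mono
  intro x
  by_cases hx : x ∈ Set.univ.pi fun i => A i ∩ IW d W i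
  · rw [Set.indicator_of_mem hx, ENNReal.ofReal_prod_of_nonneg]
    · refine Finset.prod_le_prod' fun i _ => ?_
      rw [Set.indicator_of_mem (hx i trivial).1, Set.indicator_of_mem (hx i trivial).2]
    · intro i _
      have := IW_sub d W i _ (hx i trivial).2
      exact mul_nonneg (Real.rpow_nonneg this.1.le _) (Real.rpow_nonneg (by linarith) _)
  · rw [Set.indicator_of_notMem hx]; exact zero_le

theorem stmt18 (d : ℕ) (hd : 1 ≤ d) (c₂ : ℝ) (hc₂ : 0 < c₂)
    (E F W : Finset (Fin d)) (α β : Fin d → ℝ)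
    (hαE : ∀ i ∈ E, α i ≠ 0 ∧ α i < 1) (hαEc : ∀ i ∉ E, -1 < α i)
    (hβF : ∀ i ∈ F, β i ≠ 0 ∧ β i < 1) (hβFc : ∀ i ∉ F, -1 < β i)
    (hmE : ∀ i ∈ E, α i < 0) (hmF : ∀ i ∈ F, β i < 0) :
    ∃ C : ℝ, 0 < C ∧ ∀ f : (Fin d → ℝ) → ℝ, (∀ θ, 0 ≤ f θ) →
      Integrable f (etaM d α β) → ∀ lam : ℝ, 0 < lam →
      etaM d α β {θ | ENNReal.ofReal lam <
          ⨆ t ∈ Set.Ioc (0 : ℝ) 1,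
            ∫⁻ φ in {φ : Fin d → ℝ | θ ∈ QW d W ∧ φ ∈ QW d W},
              ENNReal.ofReal (KKj d c₂ E F α β t θ φ * f φ) ∂(etaM d α β)} ≤
        ENNReal.ofReal (C / lam * ∫ θ, f θ ∂(etaM d α β)) := by
  classical
  let k : Fin d → ℝ → ℝ → ℝ → ℝ := fun i => kf c₂ (if i ∈ E then -2 * α i else 0)
    (if i ∈ E then -α i else α i) (if i ∈ F then -2 * β i else 0) (if i ∈ F then -β i else β i)
  have hG : ∀ i, Nonempty (Good (k i) (muf (2 * α i + 1) (2 * β i + 1) (IW d W i)) (IW d W i)) := by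
    intro i
    rw [IW]
    split_ifs with hW
    · apply goodR
      apply goodJ
      by_cases h : i ∈ F
      · simp only [h, if_true]; exact goodB c₂ (β i) hc₂ (hmF i h)
      · simp only [h, if_false]; exact goodA c₂ (β i) hc₂ (hβFc i h)
    · apply goodJ
      by_cases h : i ∈ E
      · simp only [h, if_true]; exact goodB c₂ (α i) hc₂ (hmE i h)
      · simp only [h, if_false]; exact goodA c₂ (α i) hc₂ (hαEc i h)
  have hQ : MeasurableSet (QW d W) := by
    rw [QW_eq]; exact MeasurableSet.univ_pi (IW_meas d W)
  have hk0 : ∀ i, ∀ t, 0 < t → ∀ x ∈ IW d W i, ∀ y ∈ IW d W i, 0 ≤ k i t x y := by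
    intro i t ht x hx y hy
    have h1 := IW_sub d W i x hx
    have h2 := IW_sub d W i y hy
    have h3 : 0 ≤ x * y := mul_nonneg h1.1.le h2.1.le
    have h4 : 0 ≤ (Real.pi - x) * (Real.pi - y) := mul_nonneg (by linarith) (by linarith)
    simp only [k, kf, Kj]
    positivity
  obtain ⟨C, hC, hmain⟩ := aux_main k _ (IW d W) (fun i => (hG i).some) hk0
    ((etaM d α β).restrict (QW d W)) (eta_box d W α β)
  refine ⟨C.toReal + 1, by positivity, ?_⟩
  intro f hf hfi lam hlam
  set η := etaM d α β with hη
  set ρ : Measure (Fin d → ℝ) := (η.restrict (QW d W)).withDensity (fun φ => ENNReal.ofReal (f φ)) with hρ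
  have hfm : AEMeasurable (fun φ => ENNReal.ofReal (f φ)) (η.restrict (QW d W)) :=
    hfi.aestronglyMeasurable.aemeasurable.restrict.ennreal_ofReal
  have hint : ∫⁻ φ, ENNReal.ofReal (f φ) ∂η = ENNReal.ofReal (∫ φ, f φ ∂η) :=
    (ofReal_integral_eq_lintegral_ofReal hfi (Filter.Eventually.of_forall hf)).symm
  have hρu : ρ Set.univ ≤ ENNReal.ofReal (∫ φ, f φ ∂η) := by
    rw [hρ, withDensity_apply _ MeasurableSet.univ, Measure.restrict_univ, ← hint]
    exact lintegral_mono' Measure.restrict_le_self le_rfl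
  have hρfin : IsFiniteMeasure ρ := ⟨lt_of_le_of_lt hρu ENNReal.ofReal_lt_top⟩
  have hρc : ρ (Set.univ.pi (IW d W))ᶜ = 0 := by
    rw [← QW_eq, hρ]
    apply withDensity_absolutelyContinuous
    rw [Measure.restrict_apply hQ.compl]; simp
  set S := {θ | ENNReal.ofReal lam <
          ⨆ t ∈ Set.Ioc (0 : ℝ) 1,
            ∫⁻ φ in {φ : Fin d → ℝ | θ ∈ QW d W ∧ φ ∈ QW d W},
              ENNReal.ofReal (KKj d c₂ E F α β t θ φ * f φ) ∂η} with hS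
  have hSQ : S ⊆ QW d W := by
    intro θ hθ
    by_contra hcon
    have : {φ : Fin d → ℝ | θ ∈ QW d W ∧ φ ∈ QW d W} = ∅ := by
      ext φ; simp [hcon]
    rw [hS, Set.mem_ofPred_eq, this] at hθ
    simp at hθ
  have hSS : ∀ x ∈ S, ∃ t ∈ Set.Ioc (0:ℝ) 1,
        ENNReal.ofReal lam < ∫⁻ y, ENNReal.ofReal (∏ i, k i t (x i) (y i)) ∂ρ := by
    intro x hx
    have hxQ := hSQ hx
    have hset : {φ : Fin d → ℝ | x ∈ QW d W ∧ φ ∈ QW d W} = QW d W := by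
      ext φ; simp [hxQ]
    rw [hS, Set.mem_ofPred_eq, hset, lt_iSup_iff] at hx
    obtain ⟨t, hx⟩ := hx
    rw [lt_iSup_iff] at hx
    obtain ⟨ht, hx⟩ := hx
    refine ⟨t, ht, hx.trans_le ?_⟩
    have hkm : Measurable fun y : Fin d → ℝ => ENNReal.ofReal (∏ i, k i t (x i) (y i)) := by
      simp only [k, kf, Kj]
      fun_prop
    rw [hρ, lintegral_withDensity_eq_lintegral_mul₀ hfm hkm.aemeasurable]
    refine lintegral_mono fun φ => ?_
    rw [Pi.mul_apply, ENNReal.ofReal_mul' (hf φ), mul_comm]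
    exact le_rfl
  have hfinal := hmain ρ hρfin hρc (ENNReal.ofReal lam) (by simpa using hlam) ENNReal.ofReal_ne_top S
    (by rw [← QW_eq]; exact hSQ) hSS
  rw [Measure.restrict_eq_self _ hSQ] at hfinal
  refine hfinal.trans ?_
  calc C * (ρ Set.univ / ENNReal.ofReal lam)
      ≤ ENNReal.ofReal (C.toReal + 1) * (ENNReal.ofReal (∫ φ, f φ ∂η) / ENNReal.ofReal lam) := by
        gcongr
        rw [← ENNReal.ofReal_toReal hC]
        apply ENNReal.ofReal_le_ofReal
        rw [ENNReal.toReal_ofReal ENNReal.toReal_nonneg]; linarith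
    _ = _ := by
        rw [← ENNReal.ofReal_div_of_pos hlam, ← ENNReal.ofReal_mul (by positivity)]
        congr 1; ring
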